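/- For every τ in the Siegel upper half-space ℍ₂ and every z ∈ ℂ², the following three-term bi-monomial relations among theta functions hold, where θᵢ denotes the theta constant θᵢ(0): θ₁θ₂·θ₁(z)θ₂(z) − θ₃θ₄·θ₃(z)θ₄(z) − θ₈θ₁₀·θ₈(z)θ₁₀(z) = 0, and θ₃θ₄·θ₁(z)θ₂(z) − θ₁θ₂·θ₃(z)θ₄(z) − θ₈θ₁₀·θ₁₃(z)θ₁₆(z) = 0. -/

import Mathlib

open scoped BigOperators

/-- Genus-two theta function with characteristic vectors `a`, `b`. -/
noncomputable def thetaFn (a b : Fin 2 → ℝ) (z : Fin 2 → ℂ) (τ : Matrix (Fin 2) (Fin 2) ℂ) : ℂ :=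
  ∑' u : Fin 2 → ℤ,
    Complex.exp ((Real.pi : ℂ) * Complex.I *
      ((∑ i, ∑ j, ((u i : ℂ) + (a i : ℂ)) * τ i j * ((u j : ℂ) + (a j : ℂ))) +
        2 * ∑ i, ((u i : ℂ) + (a i : ℂ)) * (z i + (b i : ℂ))))

/-- The sixteen theta characteristics `[(a₁,a₂);(b₁,b₂)]`, 0-indexed: entry `i` is θ_{i+1}. -/
def thetaChars : Fin 16 → (ℝ × ℝ) × (ℝ × ℝ) :=
  ![((0,0),(0,0)), ((0,0),(1,1)), ((0,0),(1,0)), ((0,0),(0,1)),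
    ((1,0),(0,0)), ((1,0),(0,1)), ((0,1),(0,0)), ((1,1),(0,0)),
    ((0,1),(1,0)), ((1,1),(1,1)), ((0,1),(0,1)), ((0,1),(1,1)),
    ((1,1),(0,1)), ((1,0),(1,0)), ((1,0),(1,1)), ((1,1),(1,0))]

/-- `th i z τ` is the theta function θ_{i+1}(z, τ). -/
noncomputable def th (i : Fin 16) (z : Fin 2 → ℂ) (τ : Matrix (Fin 2) (Fin 2) ℂ) : ℂ :=
  thetaFn ![(thetaChars i).1.1 / 2, (thetaChars i).1.2 / 2]
          ![(thetaChars i).2.1 / 2, (thetaChars i).2.2 / 2] z τ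

/-- Membership in the Siegel upper half-space ℍ₂. -/
def IsSiegel (τ : Matrix (Fin 2) (Fin 2) ℂ) : Prop :=
  τ 0 1 = τ 1 0 ∧ 0 < (τ 1 1).im ∧ (τ 0 1).im ^ 2 < (τ 0 0).im * (τ 1 1).im



open Complex in
/-- General term of the genus-two theta series. -/
noncomputable def tTerm (α β γ p₁ p₂ w₁ w₂ : ℂ) (u : ℤ × ℤ) : ℂ :=
  cexp (Real.pi * I * ((α * (u.1 + p₁) ^ 2 + 2 * β * (u.1 + p₁) * (u.2 + p₂) + γ * (u.2 + p₂) ^ 2)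
    + 2 * ((u.1 + p₁) * w₁ + (u.2 + p₂) * w₂)))

/-- The genus-two theta series with arbitrary complex characteristics. -/
noncomputable def tSum (α β γ p₁ p₂ w₁ w₂ : ℂ) : ℂ := ∑' u : ℤ × ℤ, tTerm α β γ p₁ p₂ w₁ w₂ u

open Complex in
lemma tTerm_shift (α β γ p₁ p₂ w₁ w₂ : ℂ) (u : ℤ × ℤ) :
    tTerm α β γ p₁ p₂ w₁ w₂ u =
      cexp (Real.pi * I * ((α * p₁ ^ 2 + 2 * β * p₁ * p₂ + γ * p₂ ^ 2) + 2 * (p₁ * w₁ + p₂ * w₂))) *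
      tTerm α β γ 0 0 (w₁ + α * p₁ + β * p₂) (w₂ + β * p₁ + γ * p₂) u := by
  unfold tTerm
  rw [← Complex.exp_add]
  congr 1
  ring

lemma quad_lower (a b c : ℝ) (hc : 0 < c) (h : b ^ 2 < a * c) :
    ∃ δ : ℝ, 0 < δ ∧ ∀ x y : ℝ, δ * x ^ 2 + δ * y ^ 2 ≤ a * x ^ 2 + 2 * b * x * y + c * y ^ 2 := by
  have ha : 0 < a := by
    by_contra hh
    push Not at hh
    nlinarith [sq_nonneg b]
  have hs : 0 < a + c := by linarith
  refine ⟨(a * c - b ^ 2) / (a + c), div_pos (by linarith) hs, fun x y => ?_⟩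
  rw [div_mul_eq_mul_div, div_mul_eq_mul_div, ← add_div, div_le_iff₀ hs]
  nlinarith [sq_nonneg (a * x + b * y), sq_nonneg (b * x + c * y)]

open Complex in
lemma tTerm_summable (α β γ p₁ p₂ w₁ w₂ : ℂ) (hc : 0 < γ.im) (h : β.im ^ 2 < α.im * γ.im) :
    Summable fun u => ‖tTerm α β γ p₁ p₂ w₁ w₂ u‖ := by
  obtain ⟨δ, hδ, hq⟩ := quad_lower _ _ _ hc h
  have key : ∀ v₁ v₂ : ℂ, Summable fun u => ‖tTerm α β γ 0 0 v₁ v₂ u‖ := by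
    intro v₁ v₂
    have hI : 0 < ((δ : ℂ) * I).im := by simpa using hδ
    have s₁ := ((summable_jacobiTheta₂_term_iff v₁ (δ * I)).2 hI).norm
    have s₂ := ((summable_jacobiTheta₂_term_iff v₂ (δ * I)).2 hI).norm
    refine Summable.of_nonneg_of_le (fun _ => norm_nonneg _) ?_
      (s₁.mul_of_nonneg s₂ (fun _ => norm_nonneg _) (fun _ => norm_nonneg _))
    rintro ⟨x, y⟩
    simp only [tTerm, norm_jacobiTheta₂_term, ← Real.exp_add, Complex.norm_exp]
    apply Real.exp_le_exp.2
    have := hq x y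
    have e : (Real.pi * I * ((α * (x + 0) ^ 2 + 2 * β * (x + 0) * (y + 0) + γ * (y + 0) ^ 2)
        + 2 * ((x + 0) * v₁ + (y + 0) * v₂)) : ℂ).re =
        - Real.pi * ((α.im * x ^ 2 + 2 * β.im * x * y + γ.im * y ^ 2)
          + 2 * (x * v₁.im + y * v₂.im)) := by
      have e1 : (Real.pi * I * ((α * (x + 0) ^ 2 + 2 * β * (x + 0) * (y + 0) + γ * (y + 0) ^ 2)
        + 2 * ((x + 0) * v₁ + (y + 0) * v₂)) : ℂ) =
        ((Real.pi : ℝ) : ℂ) * (I * ((((x : ℝ) ^ 2 : ℝ) : ℂ) * α + ((2 * x * y : ℝ) : ℂ) * β +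
          (((y : ℝ) ^ 2 : ℝ) : ℂ) * γ + ((2 * x : ℝ) : ℂ) * v₁ + ((2 * y : ℝ) : ℂ) * v₂)) := by
        push_cast; ring
      rw [e1, Complex.re_ofReal_mul, Complex.I_mul_re]
      simp only [Complex.add_im, Complex.im_ofReal_mul]
      ring
    rw [e]
    have := mul_le_mul_of_nonneg_left this Real.pi_pos.le
    simp only [Complex.mul_im, Complex.ofReal_re, Complex.ofReal_im, Complex.I_re, Complex.I_im]
    nlinarith
  simp only [tTerm_shift α β γ p₁ p₂, norm_mul]
  exact (key _ _).mul_left _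

lemma tSum_shift (α β γ p₁ p₂ w₁ w₂ : ℂ) (k l : ℤ) :
    tSum α β γ (p₁ + k) (p₂ + l) w₁ w₂ = tSum α β γ p₁ p₂ w₁ w₂ := by
  unfold tSum
  rw [← (Equiv.addRight ((k, l) : ℤ × ℤ)).tsum_eq (tTerm α β γ p₁ p₂ w₁ w₂)]
  refine tsum_congr fun u => ?_
  simp only [tTerm, Equiv.coe_addRight, Prod.fst_add, Prod.snd_add]
  push_cast
  congr 1
  ring

lemma tSum_neg (α β γ p₁ p₂ w₁ w₂ : ℂ) :
    tSum α β γ (-p₁) (-p₂) (-w₁) (-w₂) = tSum α β γ p₁ p₂ w₁ w₂ := by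
  unfold tSum
  rw [← (Equiv.neg (ℤ × ℤ)).tsum_eq (tTerm α β γ p₁ p₂ w₁ w₂)]
  refine tsum_congr fun u => ?_
  simp only [tTerm, Equiv.neg_apply, Prod.fst_neg, Prod.snd_neg]
  push_cast
  congr 1
  ring

open Complex in
lemma tSum_period (α β γ p₁ p₂ w₁ w₂ : ℂ) (k l : ℤ) :
    tSum α β γ p₁ p₂ (w₁ + k) (w₂ + l) =
      cexp (2 * Real.pi * I * (p₁ * k + p₂ * l)) * tSum α β γ p₁ p₂ w₁ w₂ := by
  unfold tSum
  rw [← tsum_mul_left]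
  refine tsum_congr fun u => ?_
  simp only [tTerm]
  rw [← Complex.exp_add, Complex.exp_eq_exp_iff_exists_int]
  refine ⟨u.1 * k + u.2 * l, ?_⟩
  push_cast
  ring

/-- Reindexing pairs of lattice points by half-sum, half-difference and parity class. -/
def splitMap (x : (Fin 2 × Fin 2) × ((ℤ × ℤ) × (ℤ × ℤ))) : (ℤ × ℤ) × (ℤ × ℤ) :=
  ((x.2.1.1 + x.2.2.1 + (x.1.1 : ℕ), x.2.1.2 + x.2.2.2 + (x.1.2 : ℕ)),
   (x.2.1.1 - x.2.2.1, x.2.1.2 - x.2.2.2))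

lemma splitMap_bij : Function.Bijective splitMap := by
  constructor
  · rintro ⟨⟨c, d⟩, ⟨m, m'⟩, ⟨n, n'⟩⟩ ⟨⟨e, f⟩, ⟨r, r'⟩, ⟨s, s'⟩⟩ h
    simp only [splitMap, Prod.mk.injEq] at h
    have := c.2
    have := d.2
    have := e.2
    have := f.2
    simp only [Prod.mk.injEq, Fin.ext_iff]
    omega
  · rintro ⟨⟨u, u'⟩, ⟨v, v'⟩⟩
    refine ⟨((⟨((u + v) % 2).toNat, by omega⟩, ⟨((u' + v') % 2).toNat, by omega⟩),
      (((u + v) / 2, (u' + v') / 2), ((u + v) / 2 - v, (u' + v') / 2 - v'))), ?_⟩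
    simp only [splitMap, Prod.mk.injEq]
    omega

lemma tSum_mul (α β γ a₁ a₂ w₁ w₂ v₁ v₂ : ℂ) (hc : 0 < γ.im) (h : β.im ^ 2 < α.im * γ.im) :
    tSum α β γ a₁ a₂ w₁ w₂ * tSum α β γ a₁ a₂ v₁ v₂ =
      ∑ c : Fin 2 × Fin 2,
        tSum (2 * α) (2 * β) (2 * γ) (a₁ + (c.1 : ℕ) / 2) (a₂ + (c.2 : ℕ) / 2) (w₁ + v₁) (w₂ + v₂) *
        tSum (2 * α) (2 * β) (2 * γ) ((c.1 : ℕ) / 2) ((c.2 : ℕ) / 2) (w₁ - v₁) (w₂ - v₂) := by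
  have hc' : 0 < (2 * γ).im := by simpa using hc
  have h' : (2 * β).im ^ 2 < (2 * α).im * (2 * γ).im := by
    have e : ∀ x : ℂ, (2 * x).im = 2 * x.im := by intro x; simp
    rw [e, e, e]; nlinarith
  have S1 := tTerm_summable α β γ a₁ a₂ w₁ w₂ hc h
  have S2 := tTerm_summable α β γ a₁ a₂ v₁ v₂ hc h
  have S := summable_mul_of_summable_norm S1 S2
  unfold tSum
  rw [tsum_mul_tsum_of_summable_norm S1 S2,
    ← (Equiv.ofBijective _ splitMap_bij).tsum_eq]
  have S' := (Equiv.ofBijective _ splitMap_bij).summable_iff.2 S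
  rw [← tsum_fintype (L := .unconditional _)]
  refine Eq.trans (Summable.tsum_prod S') (tsum_congr fun c => ?_)
  rw [tsum_mul_tsum_of_summable_norm (tTerm_summable _ _ _ _ _ _ _ hc' h')
    (tTerm_summable _ _ _ _ _ _ _ hc' h')]
  refine tsum_congr fun u => ?_
  simp only [Equiv.ofBijective_apply, splitMap, tTerm, ← Complex.exp_add]
  congr 1
  push_cast
  ring

lemma thetaFn_eq (a b : Fin 2 → ℝ) (z : Fin 2 → ℂ) (τ : Matrix (Fin 2) (Fin 2) ℂ)
    (hτ : τ 0 1 = τ 1 0) :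
    thetaFn a b z τ = tSum (τ 0 0) (τ 0 1) (τ 1 1) (a 0) (a 1) (z 0 + b 0) (z 1 + b 1) := by
  unfold thetaFn tSum
  rw [← (finTwoArrowEquiv ℤ).symm.tsum_eq]
  refine tsum_congr fun u => ?_
  simp only [tTerm, Fin.sum_univ_two, finTwoArrowEquiv_symm_apply, Matrix.cons_val_zero,
    Matrix.cons_val_one, ← hτ]
  congr 1
  ring

lemma exp_neg_pi : Complex.exp (-(Real.pi * Complex.I)) = -1 := by
  rw [Complex.exp_neg, Complex.exp_pi_mul_I]; norm_num

lemma products (τ : Matrix (Fin 2) (Fin 2) ℂ) (hτ : IsSiegel τ) :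
    ∃ D E : ℂ, ∃ A B : (Fin 2 → ℂ) → ℂ, D = A 0 ∧ E = B 0 ∧ ∀ z : Fin 2 → ℂ,
      th 0 z τ * th 1 z τ = A z * D + B z * E ∧
      th 2 z τ * th 3 z τ = A z * D - B z * E ∧
      th 7 z τ * th 9 z τ = B z * D + A z * E ∧
      th 12 z τ * th 15 z τ = B z * D - A z * E := by
  obtain ⟨h01, hc, h⟩ := hτ
  set α := τ 0 0
  set β := τ 0 1
  set γ := τ 1 1
  let T := tSum (2 * α) (2 * β) (2 * γ)
  have hs : ∀ p₁ p₂ w₁ w₂ (k l : ℤ), T (p₁ + k) (p₂ + l) w₁ w₂ = T p₁ p₂ w₁ w₂ :=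
    fun _ _ _ _ _ _ => tSum_shift _ _ _ _ _ _ _ _ _
  have hn : ∀ p₁ p₂ w₁ w₂, T (-p₁) (-p₂) (-w₁) (-w₂) = T p₁ p₂ w₁ w₂ :=
    fun _ _ _ _ => tSum_neg _ _ _ _ _ _ _
  have hp : ∀ p₁ p₂ w₁ w₂ (k l : ℤ), T p₁ p₂ (w₁ + k) (w₂ + l) =
      Complex.exp (2 * Real.pi * Complex.I * (p₁ * k + p₂ * l)) * T p₁ p₂ w₁ w₂ :=
    fun _ _ _ _ _ _ => tSum_period _ _ _ _ _ _ _ _ _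
  -- the values at `(±1/2, ±1/2)`
  have mm00 : T 0 0 (-(1/2)) (-(1/2)) = T 0 0 (1/2) (1/2) := by
    have := hn 0 0 (1/2) (1/2)
    simpa using this
  have pm00 : T 0 0 (1/2) (-(1/2)) = T 0 0 (1/2) (1/2) := by
    have := hp 0 0 (1/2) (1/2) 0 (-1)
    norm_num at this ⊢
    exact this
  have mp00 : T 0 0 (-(1/2)) (1/2) = T 0 0 (1/2) (1/2) := by
    have := hp 0 0 (1/2) (1/2) (-1) 0
    norm_num at this ⊢
    exact this
  have mm11 : T (1/2) (1/2) (-(1/2)) (-(1/2)) = T (1/2) (1/2) (1/2) (1/2) := by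
    have h1 := hn (1/2) (1/2) (1/2) (1/2)
    have h2 := hs (1/2) (1/2) (-(1/2)) (-(1/2)) (-1) (-1)
    norm_num at h1 h2 ⊢
    rw [← h2, h1]
  have pm11 : T (1/2) (1/2) (1/2) (-(1/2)) = - T (1/2) (1/2) (1/2) (1/2) := by
    have := hp (1/2) (1/2) (1/2) (1/2) 0 (-1)
    rw [show (2 * Real.pi * Complex.I * ((1/2) * ((0:ℤ):ℂ) + (1/2) * ((-1:ℤ):ℂ)) : ℂ)
      = -(Real.pi * Complex.I) by push_cast; ring, exp_neg_pi] at this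
    norm_num at this ⊢
    exact this
  have mp11 : T (1/2) (1/2) (-(1/2)) (1/2) = - T (1/2) (1/2) (1/2) (1/2) := by
    have := hp (1/2) (1/2) (1/2) (1/2) (-1) 0
    rw [show (2 * Real.pi * Complex.I * ((1/2) * ((-1:ℤ):ℂ) + (1/2) * ((0:ℤ):ℂ)) : ℂ)
      = -(Real.pi * Complex.I) by push_cast; ring, exp_neg_pi] at this
    norm_num at this ⊢
    exact this
  have van10 : ∀ x y : ℂ, (x = 1/2 ∨ x = -(1/2)) → (y = 1/2 ∨ y = -(1/2)) →
      T (1/2) 0 x y = 0 := by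
    have key : ∀ (k l : ℤ), (k = 1 ∨ k = -1) → T (1/2) 0 (k/2) (l/2) = 0 := by
      intro k l hk
      have h1 := hn (1/2) 0 (k/2) (l/2)
      have h2 := hs (1/2) 0 (-(k/2)) (-(l/2)) (-1) 0
      have h3 := hp (1/2) 0 (k/2) (l/2) (-k) (-l)
      have hE : Complex.exp (2 * Real.pi * Complex.I * ((1/2) * ((-k : ℤ):ℂ) + 0 * ((-l:ℤ):ℂ)))
          = -1 := by
        rcases hk with rfl | rfl
        · rw [← exp_neg_pi]; congr 1; push_cast; ring
        · rw [← Complex.exp_pi_mul_I]; congr 1; push_cast; ring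
      rw [hE] at h3
      rw [show ((k:ℂ)/2 + ((-k:ℤ):ℂ)) = -(k/2) by push_cast; ring,
        show ((l:ℂ)/2 + ((-l:ℤ):ℂ)) = -(l/2) by push_cast; ring] at h3
      rw [show ((1:ℂ)/2 + ((-1:ℤ):ℂ)) = -(1/2) by push_cast; ring,
        show ((0:ℂ) + ((0:ℤ):ℂ)) = -0 by push_cast; ring] at h2
      rw [h1, h3] at h2
      linear_combination h2 / 2
    rintro x y (rfl | rfl) (rfl | rfl)
    · simpa using key 1 1 (by simp)
    · simpa [neg_div] using key 1 (-1) (by simp)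
    · simpa [neg_div] using key (-1) 1 (by simp)
    · simpa [neg_div] using key (-1) (-1) (by simp)
  have van01 : ∀ x y : ℂ, (x = 1/2 ∨ x = -(1/2)) → (y = 1/2 ∨ y = -(1/2)) →
      T 0 (1/2) x y = 0 := by
    have key : ∀ (k l : ℤ), (l = 1 ∨ l = -1) → T 0 (1/2) (k/2) (l/2) = 0 := by
      intro k l hk
      have h1 := hn 0 (1/2) (k/2) (l/2)
      have h2 := hs 0 (1/2) (-(k/2)) (-(l/2)) 0 (-1)
      have h3 := hp 0 (1/2) (k/2) (l/2) (-k) (-l)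
      have hE : Complex.exp (2 * Real.pi * Complex.I * (0 * ((-k : ℤ):ℂ) + (1/2) * ((-l:ℤ):ℂ)))
          = -1 := by
        rcases hk with rfl | rfl
        · rw [← exp_neg_pi]; congr 1; push_cast; ring
        · rw [← Complex.exp_pi_mul_I]; congr 1; push_cast; ring
      rw [hE] at h3
      rw [show ((k:ℂ)/2 + ((-k:ℤ):ℂ)) = -(k/2) by push_cast; ring,
        show ((l:ℂ)/2 + ((-l:ℤ):ℂ)) = -(l/2) by push_cast; ring] at h3
      rw [show ((1:ℂ)/2 + ((-1:ℤ):ℂ)) = -(1/2) by push_cast; ring,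
        show ((0:ℂ) + ((0:ℤ):ℂ)) = -0 by push_cast; ring] at h2
      rw [h1, h3] at h2
      linear_combination h2 / 2
    rintro x y (rfl | rfl) (rfl | rfl)
    · simpa using key 1 1 (by simp)
    · simpa [neg_div] using key 1 (-1) (by simp)
    · simpa [neg_div] using key (-1) 1 (by simp)
    · simpa [neg_div] using key (-1) (-1) (by simp)
  have s11 : ∀ x y, T 1 1 x y = T 0 0 x y := by
    intro x y
    simpa using hs 0 0 x y 1 1
  -- products of two theta functions whose second characteristics add up to `(1/2, 1/2)`
  have prod : ∀ a x y x' y' : ℂ, (x - x' = 1/2 ∨ x - x' = -(1/2)) →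
      (y - y' = 1/2 ∨ y - y' = -(1/2)) →
      tSum α β γ a a x y * tSum α β γ a a x' y' =
        T a a (x + x') (y + y') * T 0 0 (x - x') (y - y') +
        T (a + 1/2) (a + 1/2) (x + x') (y + y') * T (1/2) (1/2) (x - x') (y - y') := by
    intro a x y x' y' hx hy
    have v1 := van10 _ _ hx hy
    have v2 := van01 _ _ hx hy
    rw [tSum_mul α β γ a a x y x' y' hc h, Fintype.sum_prod_type]
    simp only [Fin.sum_univ_two, Fin.val_zero, Fin.val_one, Nat.cast_zero, Nat.cast_one,
      zero_div, add_zero]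
    simp only [T] at v1 v2 ⊢
    rw [v1, v2]
    ring
  refine ⟨T 0 0 (1/2) (1/2), T (1/2) (1/2) (1/2) (1/2),
    fun z => T 0 0 (2 * z 0 + 1/2) (2 * z 1 + 1/2),
    fun z => T (1/2) (1/2) (2 * z 0 + 1/2) (2 * z 1 + 1/2), by simp, by simp, fun z => ?_⟩
  have hth : ∀ i, th i z τ = tSum α β γ (((thetaChars i).1.1 / 2 : ℝ) : ℂ)
      (((thetaChars i).1.2 / 2 : ℝ) : ℂ) (z 0 + ((thetaChars i).2.1 / 2 : ℝ))
      (z 1 + ((thetaChars i).2.2 / 2 : ℝ)) := by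
    intro i
    unfold th
    rw [thetaFn_eq _ _ _ _ h01]
    simp [α, β, γ]
  have c0 : thetaChars 0 = ((0,0),(0,0)) := rfl
  have c1 : thetaChars 1 = ((0,0),(1,1)) := rfl
  have c2 : thetaChars 2 = ((0,0),(1,0)) := rfl
  have c3 : thetaChars 3 = ((0,0),(0,1)) := rfl
  have c7 : thetaChars 7 = ((1,1),(0,0)) := rfl
  have c9 : thetaChars 9 = ((1,1),(1,1)) := rfl
  have c12 : thetaChars 12 = ((1,1),(0,1)) := rfl
  have c15 : thetaChars 15 = ((1,1),(1,0)) := rfl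
  have n0 : ((0 / 2 : ℝ) : ℂ) = 0 := by norm_num
  have n1 : ((1 / 2 : ℝ) : ℂ) = 1 / 2 := by norm_num
  have d1 : ∀ w : ℂ, (w + 0) - (w + 1/2) = -(1/2) := by intro w; ring
  have d2 : ∀ w : ℂ, (w + 1/2) - (w + 0) = 1/2 := by intro w; ring
  have e1 : ∀ w : ℂ, (w + 0) + (w + 1/2) = 2 * w + 1/2 := by intro w; ring
  have e2 : ∀ w : ℂ, (w + 1/2) + (w + 0) = 2 * w + 1/2 := by intro w; ring
  have hh : (1/2 : ℂ) + 1/2 = 1 := by norm_num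
  simp only [hth, c0, c1, c2, c3, c7, c9, c12, c15, n0, n1]
  refine ⟨?_, ?_, ?_, ?_⟩
  · rw [prod _ _ _ _ _ (.inr (d1 _)) (.inr (d1 _)), d1, d1, e1, e1, zero_add, mm00, mm11]
  · rw [prod _ _ _ _ _ (.inl (d2 _)) (.inr (d1 _)), d2, d1, e2, e1, zero_add, pm00, pm11]
    ring
  · rw [prod _ _ _ _ _ (.inr (d1 _)) (.inr (d1 _)), d1, d1, e1, e1, hh, s11, mm00, mm11]
  · rw [prod _ _ _ _ _ (.inr (d1 _)) (.inl (d2 _)), d1, d2, e1, e2, hh, s11, mp00, mp11]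
    ring

/-- Two of the three-term bi-monomial Mumford relations among theta functions. -/
theorem mumford_bimonomial (τ : Matrix (Fin 2) (Fin 2) ℂ) (hτ : IsSiegel τ)
    (z : Fin 2 → ℂ) :
    th 0 0 τ * th 1 0 τ * (th 0 z τ * th 1 z τ)
      - th 2 0 τ * th 3 0 τ * (th 2 z τ * th 3 z τ)
      - th 7 0 τ * th 9 0 τ * (th 7 z τ * th 9 z τ) = 0 ∧
    th 2 0 τ * th 3 0 τ * (th 0 z τ * th 1 z τ)
      - th 0 0 τ * th 1 0 τ * (th 2 z τ * th 3 z τ)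
      - th 7 0 τ * th 9 0 τ * (th 12 z τ * th 15 z τ) = 0 := by
  obtain ⟨D, E, A, B, hD, hE, H⟩ := products τ hτ
  obtain ⟨h1, h2, h3, h4⟩ := H z
  obtain ⟨k1, k2, k3, -⟩ := H 0
  rw [h1, h2, h3, h4, k1, k2, k3, ← hD, ← hE]
  constructor <;> ring
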